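/- Let f : ℝ^d → ℝ be differentiable with L-Lipschitz gradient, x ∈ ℝ^d with ∇f(x) ≠ 0, ν > 0, and u uniform on the unit sphere S^{d-1} (d ≥ 3). Define h_ν(x) = sign(f(x + νu) - f(x - νu)) u. Then for any unit vector v, |E[⟨h_ν(x), v⟩] - (ĉ/√d)⟨∇f(x)/‖∇f(x)‖, v⟩| ≤ 2γ, where ĉ = √d · E[|u₁|] ∈ [1/√(2π), 1] and γ = √(d/(2π)) · Lν/‖∇f(x)‖. -/

import Mathlib

open MeasureTheory RealInnerProductSpace

lemma aux_scale {E : Type*} [NormedAddCommGroup E] [NormedSpace ℝ E] [MeasurableSpace E]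
    [BorelSpace E] [FiniteDimensional ℝ E] (m : Measure E) [m.IsAddHaarMeasure]
    (F : E → ENNReal) {c : ℝ} (hc : 0 < c) :
    ∫⁻ y, F (c • y) ∂m = ENNReal.ofReal ((c ^ Module.finrank ℝ E)⁻¹) * ∫⁻ y, F y ∂m := by
  have h := Measure.map_addHaar_smul m hc.ne'
  have e := lintegral_map_equiv (μ := m) F (Homeomorph.smulOfNeZero c hc.ne').toMeasurableEquiv
  have e2 : Measure.map (Homeomorph.smulOfNeZero c hc.ne').toMeasurableEquiv m
    = Measure.map (fun x => c • x) m := rfl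
  have e3 : ∫⁻ y, F (c • y) ∂m = ∫⁻ y, F y ∂(Measure.map (fun x => c • x) m) := by
    rw [← e2, e]; rfl
  rw [e3]
  have h' : Measure.map (fun x => c • x) m =
    ENNReal.ofReal ((c ^ Module.finrank ℝ E)⁻¹) • m := by
    rw [← abs_of_pos (show 0 < (c ^ Module.finrank ℝ E)⁻¹ by positivity)]; exact h
  rw [h', lintegral_smul_measure, smul_eq_mul]

lemma aux_int0 : ∫ y : ℝ, Real.exp (-(y^2)/2) = √(2 * Real.pi) := by
  have := integral_gaussian (1/2)
  rw [show Real.pi / (1/2) = 2 * Real.pi by ring] at this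
  rw [← this]; congr 1; ext y; congr 1; ring

lemma aux_itg0 : Integrable fun y : ℝ => Real.exp (-(y^2)/2) := by
  have := integrable_exp_neg_mul_sq (b := 1/2) (by norm_num)
  refine this.congr (.of_forall fun y => ?_)
  simp only; congr 1; ring

lemma aux_itg2 : Integrable fun y : ℝ => y^2 * Real.exp (-(y^2)/2) := by
  have := integrable_rpow_mul_exp_neg_mul_sq (b := 1/2) (by norm_num) (s := 2) (by norm_num)
  refine this.congr (.of_forall fun y => ?_)
  simp only [Real.rpow_two]; congr 2; ring

lemma aux_int2 : ∫ y : ℝ, y^2 * Real.exp (-(y^2)/2) = √(2 * Real.pi) := by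
  have h := ProbabilityTheory.variance_fun_id_gaussianReal (μ := 0) (v := 1)
  rw [ProbabilityTheory.variance_eq_integral (by fun_prop)] at h
  simp only [ProbabilityTheory.integral_id_gaussianReal, sub_zero] at h
  rw [ProbabilityTheory.integral_gaussianReal_eq_integral_smul (by norm_num)] at h
  simp only [ProbabilityTheory.gaussianPDFReal, smul_eq_mul, sub_zero, NNReal.coe_one, mul_one,
    mul_assoc] at h
  rw [integral_const_mul] at h
  have hp : √(2 * Real.pi) ≠ 0 := by positivity
  field_simp at h
  rw [← h]; simp only [neg_div]

lemma aux_exp_prod {n : ℕ} (y : Fin n → ℝ) :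
    Real.exp (-(∑ i, y i ^ 2)/2) = ∏ i, Real.exp (-(y i^2)/2) := by
  rw [← Real.exp_sum]; congr 1
  rw [← Finset.sum_div, Finset.sum_neg_distrib]

lemma aux_itgN (n : ℕ) : Integrable fun y : Fin n → ℝ => Real.exp (-(∑ i, y i ^ 2)/2) := by
  simp only [aux_exp_prod]
  exact Integrable.fintype_prod (f := fun _ (t : ℝ) => Real.exp (-(t^2)/2)) fun _ => aux_itg0

lemma aux_intN (n : ℕ) : ∫ y : Fin n → ℝ, Real.exp (-(∑ i, y i ^ 2)/2) = √(2 * Real.pi) ^ n := by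
  simp only [aux_exp_prod]
  rw [integral_fintype_prod_volume_eq_pow (fun t : ℝ => Real.exp (-(t^2)/2)), aux_int0]; simp

lemma aux_N (n : ℕ) : ∫⁻ y : Fin n → ℝ, ENNReal.ofReal (Real.exp (-(∑ i, y i ^ 2)/2))
    = ENNReal.ofReal (√(2 * Real.pi) ^ n) := by
  rw [← ofReal_integral_eq_lintegral_ofReal (aux_itgN n) (.of_forall fun y => by positivity),
    aux_intN]

lemma aux_sq_prod {n : ℕ} (y : Fin n → ℝ) (k : Fin n) :
    y k ^ 2 * Real.exp (-(∑ i, y i ^ 2)/2)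
      = ∏ i, (fun t : ℝ => (if i = k then t ^ 2 else 1) * Real.exp (-(t^2)/2)) (y i) := by
  simp only [Finset.prod_mul_distrib, aux_exp_prod]
  simp

lemma aux_sq (n : ℕ) (k : Fin n) :
    Integrable (fun y : Fin n → ℝ => y k ^ 2 * Real.exp (-(∑ i, y i ^ 2)/2)) ∧
    ∫ y : Fin n → ℝ, y k ^ 2 * Real.exp (-(∑ i, y i ^ 2)/2) = √(2 * Real.pi) ^ n := by
  simp only [aux_sq_prod]
  constructor
  · refine Integrable.fintype_prod
      (f := fun i (t : ℝ) => (if i = k then t ^ 2 else 1) * Real.exp (-(t^2)/2)) fun i => ?_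
    by_cases h : i = k
    · simpa [h] using aux_itg2
    · simpa [h] using aux_itg0
  · rw [integral_fintype_prod_volume_eq_prod
      (fun (i : Fin n) (t : ℝ) => (if i = k then t ^ 2 else 1) * Real.exp (-(t^2)/2))]
    rw [Finset.prod_congr rfl (g := fun _ => √(2 * Real.pi))]
    · simp
    · intro i _
      by_cases h : i = k
      · simpa [h] using aux_int2
      · simpa [h] using aux_int0

lemma aux_M (n : ℕ) (hn : 0 < n) :
    ∫⁻ y : Fin n → ℝ, ENNReal.ofReal (√(∑ i, y i ^ 2) * Real.exp (-(∑ i, y i ^ 2)/2))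
      ≤ ENNReal.ofReal (√n * √(2 * Real.pi) ^ n) := by
  have hn' : (0:ℝ) < √n := by positivity
  set G : (Fin n → ℝ) → ℝ := fun y => (2 * √n)⁻¹ * (∑ k, y k ^ 2 * Real.exp (-(∑ i, y i ^ 2)/2))
    + √n / 2 * Real.exp (-(∑ i, y i ^ 2)/2) with hG
  have hI1 : Integrable fun y : Fin n → ℝ => (2 * √n)⁻¹ * (∑ k, y k ^ 2 * Real.exp (-(∑ i, y i ^ 2)/2)) :=
    (integrable_finsetSum _ fun k _ => (aux_sq n k).1).const_mul _
  have hI2 := (aux_itgN n).const_mul (√n / 2)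
  have hI : Integrable G := hI1.add hI2
  have hv : ∫ y, G y = √n * √(2 * Real.pi) ^ n := by
    rw [hG, integral_add hI1 hI2, integral_const_mul, integral_const_mul, aux_intN,
      integral_finsetSum _ fun k _ => (aux_sq n k).1]
    simp only [(aux_sq n _).2]
    simp only [Finset.sum_const, Finset.card_univ, Fintype.card_fin, nsmul_eq_mul]
    have : (n:ℝ) = √n * √n := (Real.mul_self_sqrt (by positivity)).symm
    rw [show ((2 * √n)⁻¹ * (↑n * √(2 * Real.pi) ^ n)) = ((2 * √n)⁻¹ * ((√n * √n) * √(2 * Real.pi) ^ n)) by rw [← this]]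
    field_simp; norm_num
  rw [← hv, ofReal_integral_eq_lintegral_ofReal hI (.of_forall fun y => by positivity)]
  refine lintegral_mono fun y => ENNReal.ofReal_le_ofReal ?_
  simp only [hG]
  rw [← Finset.sum_mul, ← mul_assoc, ← add_mul]
  refine mul_le_mul_of_nonneg_right ?_ (by positivity)
  set q := ∑ i, y i ^ 2
  have hq : 0 ≤ q := by positivity
  have : q = √q * √q := (Real.mul_self_sqrt hq).symm
  rw [show (2 * √n)⁻¹ * q = (2 * √n)⁻¹ * (√q * √q) by rw [← this]]
  field_simp
  nlinarith [sq_nonneg (√q - √n)]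

lemma aux_M' (n : ℕ) (s : ℝ) :
    ∫⁻ y : Fin n → ℝ, ENNReal.ofReal (√(∑ i, y i ^ 2) * Real.exp (-((1 + s^2) * ∑ i, y i ^ 2)/2))
      = ENNReal.ofReal ((√(1+s^2) ^ (n+1))⁻¹) * 
        ∫⁻ y : Fin n → ℝ, ENNReal.ofReal (√(∑ i, y i ^ 2) * Real.exp (-(∑ i, y i ^ 2)/2)) := by
  set c := √(1+s^2) with hcdef
  have hc : 0 < c := by positivity
  have hc2 : 1 + s^2 = c^2 := (Real.sq_sqrt (by positivity)).symm
  have h := aux_scale (volume : Measure (Fin n → ℝ)) (fun y => ENNReal.ofReal (√(∑ i, y i ^ 2) * Real.exp (-(∑ i, y i ^ 2)/2))) hc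
  simp only [Module.finrank_fin_fun] at h
  have e : ∀ y : Fin n → ℝ, ENNReal.ofReal (√(∑ i, y i ^ 2) * Real.exp (-((1 + s^2) * ∑ i, y i ^ 2)/2))
     = ENNReal.ofReal c⁻¹ * ENNReal.ofReal (√(∑ i, (c • y) i ^ 2) * Real.exp (-(∑ i, (c • y) i ^ 2)/2)) := by
    intro y
    rw [← ENNReal.ofReal_mul (by positivity)]
    simp only [Pi.smul_apply, smul_eq_mul, mul_pow, ← Finset.mul_sum, hc2]
    rw [Real.sqrt_mul (by positivity), Real.sqrt_sq hc.le]
    congr 1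
    field_simp
  simp only [e]
  rw [lintegral_const_mul' _ _ ENNReal.ofReal_ne_top, h, ← mul_assoc, ← ENNReal.ofReal_mul (by positivity)]
  congr 2
  rw [pow_succ, mul_inv, mul_comm]

lemma aux_inner (r s : ℝ) (hr : 0 ≤ r) :
    ∫⁻ a : ℝ, (if |a| ≤ s * r then ENNReal.ofReal (Real.exp (-(a^2)/2)) else 0)
     = ∫⁻ σ in Set.Icc (-s) s, ENNReal.ofReal (r * Real.exp (-(σ^2 * r^2)/2)) := by
  rcases hr.eq_or_lt with rfl | hr
  · simp only [mul_zero, zero_mul, ENNReal.ofReal_zero, lintegral_zero]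
    rw [lintegral_eq_zero_iff' ]
    · have : ∀ᵐ a : ℝ, a ≠ 0 := by simp [ae_iff]
      filter_upwards [this] with a ha
      simp [ha]
    · apply Measurable.aemeasurable
      refine Measurable.ite ?_ (by fun_prop) (by fun_prop)
      exact measurableSet_le (by fun_prop) (by fun_prop)
  · have h := aux_scale (volume : Measure ℝ) (fun a => (if |a| ≤ s * r then ENNReal.ofReal (Real.exp (-(a^2)/2)) else 0)) hr
    simp only [Module.finrank_self, pow_one, smul_eq_mul] at h
    have h2 : ∫⁻ a : ℝ, (if |a| ≤ s * r then ENNReal.ofReal (Real.exp (-(a^2)/2)) else 0)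
       = ENNReal.ofReal r * ∫⁻ a : ℝ, (if |r*a| ≤ s * r then ENNReal.ofReal (Real.exp (-((r*a)^2)/2)) else 0) := by
      rw [h, ← mul_assoc, ← ENNReal.ofReal_mul hr.le, mul_inv_cancel₀ hr.ne']; simp
    rw [h2, ← lintegral_const_mul' _ _ ENNReal.ofReal_ne_top, ← lintegral_indicator measurableSet_Icc]
    congr 1; ext a
    have : |r * a| ≤ s * r ↔ a ∈ Set.Icc (-s) s := by
      rw [abs_mul, abs_of_pos hr, mul_comm, mul_le_mul_iff_left₀ hr, abs_le, Set.mem_Icc]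
    by_cases ha : a ∈ Set.Icc (-s) s
    · rw [if_pos (this.2 ha), Set.indicator_of_mem ha, ← ENNReal.ofReal_mul hr.le]
      congr 4; ring
    · rw [if_neg (fun h => ha (this.1 h)), Set.indicator_of_notMem ha, mul_zero]

lemma aux_sigma (n : ℕ) (hn : 2 ≤ n) (s : ℝ) (hs : 0 ≤ s) :
    ∫⁻ σ in Set.Icc (-s) s, ENNReal.ofReal ((√(1+σ^2) ^ (n+1))⁻¹) ≤ ENNReal.ofReal (2 * (s / √(1+s^2))) := by
  have hcont : Continuous fun σ : ℝ => (√(1+σ^2) ^ 3)⁻¹ := by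
    refine Continuous.inv₀ (by fun_prop) (fun σ => by positivity)
  have h1 : ∫ σ in (-s)..s, (√(1+σ^2) ^ 3)⁻¹ = 2 * (s / √(1+s^2)) := by
    rw [intervalIntegral.integral_eq_sub_of_hasDerivAt (f := fun σ => σ / √(1+σ^2))]
    · simp; ring
    · intro σ _
      have hpos : 0 < 1 + σ^2 := by positivity
      have hd : HasDerivAt (fun σ : ℝ => 1 + σ^2) (2*σ) σ := by
        simpa using ((hasDerivAt_id σ).pow 2).const_add 1
      have := (hasDerivAt_id σ).div (hd.sqrt hpos.ne') (by positivity)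
      convert! this using 1
      simp only [id]
      have h2 : √(1+σ^2)^2 = 1 + σ^2 := Real.sq_sqrt hpos.le
      field_simp
      rw [h2]; ring
    · exact hcont.intervalIntegrable _ _
  rw [← h1, intervalIntegral.integral_of_le (by linarith), ← integral_Icc_eq_integral_Ioc,
    ofReal_integral_eq_lintegral_ofReal (hcont.continuousOn.integrableOn_compact isCompact_Icc) (.of_forall fun y => by positivity)]
  refine lintegral_mono fun σ => ENNReal.ofReal_le_ofReal ?_
  have : 1 ≤ √(1+σ^2) := Real.one_le_sqrt.2 (by nlinarith [sq_nonneg σ])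
  gcongr
  omega

lemma aux_Q (n : ℕ) (hn : 2 ≤ n) (s : ℝ) (hs : 0 ≤ s) :
    ∫⁻ a : ℝ, ∫⁻ y : Fin n → ℝ, (if |a| ≤ s * √(∑ i, y i ^ 2) then
      ENNReal.ofReal (Real.exp (-(a^2 + ∑ i, y i ^ 2)/2)) else 0)
     ≤ ENNReal.ofReal (2 * (s / √(1+s^2)) * (√n * √(2 * Real.pi) ^ n)) := by
  rw [lintegral_lintegral_swap]
  · have e : ∀ y : Fin n → ℝ, (∫⁻ a : ℝ, (if |a| ≤ s * √(∑ i, y i ^ 2) then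
      ENNReal.ofReal (Real.exp (-(a^2 + ∑ i, y i ^ 2)/2)) else 0))
      = ∫⁻ σ in Set.Icc (-s) s, ENNReal.ofReal (√(∑ i, y i ^ 2) * Real.exp (-((1 + σ^2) * ∑ i, y i ^ 2)/2)) := by
      intro y
      set q := ∑ i, y i ^ 2
      have hq : 0 ≤ q := by positivity
      have : ∀ a : ℝ, (if |a| ≤ s * √q then
        ENNReal.ofReal (Real.exp (-(a^2 + q)/2)) else 0) = ENNReal.ofReal (Real.exp (-q/2)) * 
        (if |a| ≤ s * √q then ENNReal.ofReal (Real.exp (-(a^2)/2)) else 0) := by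
        intro a
        split_ifs
        · rw [← ENNReal.ofReal_mul (by positivity), ← Real.exp_add]; congr 2; ring
        · simp
      simp only [this]
      rw [lintegral_const_mul' _ _ ENNReal.ofReal_ne_top, aux_inner _ _ (by positivity),
        ← lintegral_const_mul' _ _ ENNReal.ofReal_ne_top]
      congr 1; ext σ
      rw [← ENNReal.ofReal_mul (by positivity), mul_left_comm, ← Real.exp_add, Real.sq_sqrt hq]
      congr 3; ring
    simp only [e]
    rw [lintegral_lintegral_swap]
    · simp only [aux_M']
      rw [lintegral_mul_const _ (by fun_prop), ENNReal.ofReal_mul (by positivity)]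
      exact mul_le_mul' (aux_sigma n hn s hs) (aux_M n (by omega))
    · apply Measurable.aemeasurable
      unfold Function.uncurry
      fun_prop
  · apply Measurable.aemeasurable
    unfold Function.uncurry
    refine Measurable.ite ?_ (by fun_prop) (by fun_prop)
    exact measurableSet_le (by fun_prop) (by fun_prop)

lemma aux_refl {E : Type*} [NormedAddCommGroup E] [InnerProductSpace ℝ E] [FiniteDimensional ℝ E]
    (e e' : E) (h : ‖e‖ = ‖e'‖) : ∃ R : E ≃ₗᵢ[ℝ] E, R e = e' :=
  ⟨Submodule.reflection (ℝ ∙ (e - e'))ᗮ, Submodule.reflection_sub h⟩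

lemma aux_rot {d : ℕ} (μ : Measure (EuclideanSpace ℝ (Fin d)))
    (hrot : ∀ R : EuclideanSpace ℝ (Fin d) ≃ₗᵢ[ℝ] EuclideanSpace ℝ (Fin d),
      Measure.map (⇑R) μ = μ) (e e' : EuclideanSpace ℝ (Fin d)) (h : ‖e‖ = ‖e'‖) :
    Measure.map (fun u => ⟪e, u⟫) μ = Measure.map (fun u => ⟪e', u⟫) μ := by
  obtain ⟨R, hR⟩ := aux_refl e e' h
  conv_rhs => rw [← hrot R]
  rw [Measure.map_map (by fun_prop) (by fun_prop)]
  congr 1; ext u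
  simp [← hR]

lemma aux_split (n : ℕ) (H : EuclideanSpace ℝ (Fin (n+1)) → ENNReal) (hH : Measurable H) :
    ∫⁻ w, H w = ∫⁻ a : ℝ, ∫⁻ y : Fin n → ℝ, H (WithLp.toLp 2 (Fin.cons a y)) := by
  rw [← (PiLp.volume_preserving_toLp (Fin (n+1))).lintegral_comp hH,
    ← (volume_preserving_piFinSuccAbove (fun _ : Fin (n+1) => ℝ) 0).symm.lintegral_comp (by fun_prop),
    Measure.volume_eq_prod, lintegral_prod _ (by apply Measurable.aemeasurable; fun_prop)]
  simp [MeasurableEquiv.piFinSuccAbove_symm_apply, Fin.insertNthEquiv]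

lemma aux_ball {n : ℕ} (hn : 2 ≤ n) (μ : Measure (EuclideanSpace ℝ (Fin (n+1))))
    [IsProbabilityMeasure μ]
    (hsphere : ∀ᵐ u ∂μ, ‖u‖ = 1)
    (hrot : ∀ R : EuclideanSpace ℝ (Fin (n+1)) ≃ₗᵢ[ℝ] EuclideanSpace ℝ (Fin (n+1)),
      Measure.map (⇑R) μ = μ) (e : EuclideanSpace ℝ (Fin (n+1))) (he : ‖e‖ = 1)
    (t : ℝ) (ht : 0 ≤ t) :
    μ.real {u | |⟪e, u⟫| ≤ t} ≤ 2 * t * √((n+1 : ℕ) / (2 * Real.pi)) := by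
  rcases le_or_gt 1 t with h1 | h1
  · refine measureReal_le_one.trans ?_
    have : (1/2 : ℝ) ≤ √((n+1 : ℕ) / (2 * Real.pi)) := by
      apply Real.le_sqrt_of_sq_le
      rw [le_div_iff₀ (by positivity)]
      have : (2:ℝ) ≤ n := by exact_mod_cast hn
      push_cast
      nlinarith [Real.pi_lt_four]
    nlinarith
  set s := t / √(1 - t^2) with hsdef
  have h1t : 0 < 1 - t^2 := by nlinarith
  have hs : 0 ≤ s := by positivity
  have hs2 : 1 + s^2 = (1 - t^2)⁻¹ := by
    rw [hsdef, div_pow, Real.sq_sqrt h1t.le]; field_simp; ring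
  have hst : s / √(1 + s^2) = t := by
    rw [hs2, Real.sqrt_inv, hsdef]; field_simp
  have hiff : ∀ a q : ℝ, 0 ≤ q → (|a| ≤ t * √(a^2 + q) ↔ |a| ≤ s * √q) := by
    intro a q hq
    rw [← sq_le_sq₀ (by positivity) (by positivity), ← sq_le_sq₀ (a := |a|) (b := s * √q) (by positivity) (by positivity),
      mul_pow, mul_pow, sq_abs, Real.sq_sqrt (by positivity), Real.sq_sqrt hq, hsdef, div_pow,
      Real.sq_sqrt h1t.le, div_mul_eq_mul_div, le_div_iff₀ h1t]
    constructor <;> intro h <;> nlinarith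
  set p := μ {u | |⟪e, u⟫| ≤ t} with hp
  set e0 : EuclideanSpace ℝ (Fin (n+1)) := EuclideanSpace.single 0 1 with he0
  have he0n : ‖e0‖ = 1 := by simp [he0]
  let K : EuclideanSpace ℝ (Fin (n+1)) → EuclideanSpace ℝ (Fin (n+1)) → ENNReal := fun u w =>
    if |⟪w, u⟫| ≤ t * ‖w‖ then ENNReal.ofReal (Real.exp (-‖w‖^2/2)) else 0
  have hK : Measurable (Function.uncurry K) := by
    unfold Function.uncurry
    refine Measurable.ite ?_ (by fun_prop) (by fun_prop)
    exact measurableSet_le (by fun_prop) (by fun_prop)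
  have hKu : ∀ u, Measurable (K u) := fun u => hK.of_uncurry_left
  have hA : ∀ w, w ≠ 0 → ∫⁻ u, K u w ∂μ = p * ENNReal.ofReal (Real.exp (-‖w‖^2/2)) := by
    intro w hw
    have hw' : 0 < ‖w‖ := norm_pos_iff.2 hw
    have hm : MeasurableSet {a : ℝ | |a| ≤ t} := measurableSet_le (by fun_prop) (by fun_prop)
    have h2 : μ {u | |⟪w, u⟫| ≤ t * ‖w‖} = p := by
      have h3 := aux_rot μ hrot (‖w‖⁻¹ • w) e (by rw [norm_smul, norm_inv, norm_norm, inv_mul_cancel₀ hw'.ne', he])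
      have h4 := congrArg (fun m => m {a : ℝ | |a| ≤ t}) h3
      beta_reduce at h4
      rw [Measure.map_apply (by fun_prop) hm, Measure.map_apply (by fun_prop) hm] at h4
      rw [hp]
      refine Eq.trans ?_ h4
      congr 1
      ext u
      simp only [Set.mem_ofPred_eq, Set.mem_preimage, real_inner_smul_left, abs_mul, abs_inv, abs_norm]
      rw [inv_mul_le_iff₀ hw', mul_comm]
    have hm2 : MeasurableSet {u | |⟪w, u⟫| ≤ t * ‖w‖} := measurableSet_le (by fun_prop) (by fun_prop)
    rw [← h2, mul_comm, ← lintegral_indicator_const hm2]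
    rfl
  have hB : ∫⁻ w, ∫⁻ u, K u w ∂μ = p * ENNReal.ofReal (√(2 * Real.pi) ^ (n+1)) := by
    rw [← aux_N (n+1), ← (PiLp.volume_preserving_ofLp (Fin (n+1))).lintegral_comp (by fun_prop),
      ← lintegral_const_mul _ (by fun_prop)]
    apply lintegral_congr_ae
    have : ∀ᵐ w : EuclideanSpace ℝ (Fin (n+1)), w ≠ 0 := by simp [ae_iff]
    filter_upwards [this] with w hw
    rw [hA w hw, EuclideanSpace.real_norm_sq_eq]
  have hC : ∀ u, ‖u‖ = 1 → ∫⁻ w, K u w ≤ ENNReal.ofReal (2 * t * (√n * √(2 * Real.pi) ^ n)) := by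
    intro u hu
    obtain ⟨R, hR⟩ := aux_refl u e0 (by rw [hu, he0n])
    have h5 : ∫⁻ w, K u w = ∫⁻ w, K e0 w := by
      rw [← R.measurePreserving.lintegral_comp (hKu e0)]
      congr 1; ext w
      simp only [K, ← hR, R.inner_map_map, R.norm_map]
    rw [h5, aux_split n _ (hKu e0)]
    refine le_trans (le_of_eq ?_) ((aux_Q n hn s hs).trans_eq (by rw [hst]))
    congr 1; ext a; congr 1; ext y
    have hq : (0:ℝ) ≤ ∑ i, y i ^ 2 := by positivity
    have hnorm : ‖(WithLp.toLp 2 (Fin.cons a y : Fin (n+1) → ℝ) : EuclideanSpace ℝ (Fin (n+1)))‖ = √(a^2 + ∑ i, y i ^ 2) := by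
      rw [EuclideanSpace.norm_eq]; simp [Fin.sum_univ_succ]
    simp only [K]
    rw [hnorm, Real.sq_sqrt (by positivity)]
    have hin : ⟪(WithLp.toLp 2 (Fin.cons a y : Fin (n+1) → ℝ) : EuclideanSpace ℝ (Fin (n+1))), e0⟫ = a := by
      simp [he0, EuclideanSpace.inner_single_right]
    rw [hin]
    simp only [hiff a _ hq]
  have hD : ∫⁻ w, ∫⁻ u, K u w ∂μ ≤ ENNReal.ofReal (2 * t * (√n * √(2 * Real.pi) ^ n)) := by
    rw [← lintegral_lintegral_swap (f := K) hK.aemeasurable]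
    calc ∫⁻ u, ∫⁻ w, K u w ∂volume ∂μ ≤ ∫⁻ u, ENNReal.ofReal (2 * t * (√n * √(2 * Real.pi) ^ n)) ∂μ := by
          apply lintegral_mono_ae
          filter_upwards [hsphere] with u hu using hC u hu
      _ = _ := by simp
  rw [hB] at hD
  have hpr : p = ENNReal.ofReal (μ.real {u | |⟪e, u⟫| ≤ t}) := by
    rw [ofReal_measureReal]
  rw [hpr, ← ENNReal.ofReal_mul (by positivity), ENNReal.ofReal_le_ofReal_iff (by positivity)] at hD
  have hpi : 0 < √(2 * Real.pi) := by positivity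
  have h6 : μ.real {u | |⟪e, u⟫| ≤ t} * √(2 * Real.pi) ≤ 2 * t * √n := by
    rw [pow_succ'] at hD
    have : 0 < √(2 * Real.pi) ^ n := by positivity
    refine le_of_mul_le_mul_right ?_ this
    linarith
  rw [Real.sqrt_div (by positivity), ← mul_div_assoc, le_div_iff₀ hpi]
  refine h6.trans ?_
  gcongr
  omega

lemma aux_taylor {E : Type*} [NormedAddCommGroup E] [InnerProductSpace ℝ E] [CompleteSpace E]
    (f : E → ℝ) (g : E → E) (L : ℝ)
    (hg : ∀ y, HasGradientAt f (g y) y)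
    (hLip : ∀ y z, ‖g y - g z‖ ≤ L * ‖y - z‖) (x u : E) (hu : ‖u‖ = 1) (ν : ℝ) (hν : 0 < ν) :
    |f (x + ν • u) - f (x - ν • u) - 2 * ν * ⟪g x, u⟫| ≤ L * ν^2 := by
  have hd : ∀ τ : ℝ, HasDerivAt (fun τ : ℝ => f (x + τ • u) - f (x - τ • u) - 2 * τ * ⟪g x, u⟫)
      (⟪g (x + τ • u), u⟫ - -⟪g (x - τ • u), u⟫ - 2 * ⟪g x, u⟫) τ := by
    intro τ
    have h1 : HasDerivAt (fun τ : ℝ => x + τ • u) u τ := by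
      simpa using ((hasDerivAt_id τ).smul_const u).const_add x
    have h2 : HasDerivAt (fun τ : ℝ => x - τ • u) (-u) τ := by
      simpa using ((hasDerivAt_id τ).smul_const u).const_sub x
    have h3 := (hg (x + τ • u)).hasFDerivAt.comp_hasDerivAt τ h1
    have h4 := (hg (x - τ • u)).hasFDerivAt.comp_hasDerivAt τ h2
    have h5 : HasDerivAt (fun τ : ℝ => 2 * τ * ⟪g x, u⟫) (2 * ⟪g x, u⟫) τ := by
      simpa using ((hasDerivAt_id τ).const_mul 2).mul_const ⟪g x, u⟫
    convert! (h3.sub h4).sub h5 using 1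
    simp
  have := image_norm_le_of_norm_deriv_right_le_deriv_boundary (a := 0) (b := ν)
    (f := fun τ : ℝ => f (x + τ • u) - f (x - τ • u) - 2 * τ * ⟪g x, u⟫)
    (f' := fun τ => (⟪g (x + τ • u), u⟫ - -⟪g (x - τ • u), u⟫ - 2 * ⟪g x, u⟫))
    (B := fun τ => L * τ^2) (B' := fun τ => L * (2 * τ))
    (fun τ _ => (hd τ).continuousAt.continuousWithinAt)
    (fun τ _ => (hd τ).hasDerivWithinAt) (by simp)
    (fun τ => by simpa using ((hasDerivAt_id τ).pow 2).const_mul L)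
    (by
      intro τ hτ
      have e : ⟪g (x + τ • u), u⟫ - -⟪g (x - τ • u), u⟫ - 2 * ⟪g x, u⟫
        = ⟪g (x + τ • u) - g x, u⟫ + ⟪g (x - τ • u) - g x, u⟫ := by
        simp only [inner_sub_left]; ring
      have b1 := (norm_inner_le_norm (𝕜 := ℝ) (g (x + τ • u) - g x) u)
      have b2 := (norm_inner_le_norm (𝕜 := ℝ) (g (x - τ • u) - g x) u)
      have c1 := hLip (x + τ • u) x
      have c2 := hLip (x - τ • u) x
      have n1 : ‖x + τ • u - x‖ = τ := by
        rw [add_sub_cancel_left, norm_smul, hu, mul_one, Real.norm_of_nonneg hτ.1]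
      have n2 : ‖x - τ • u - x‖ = τ := by
        rw [sub_sub_cancel_left, norm_neg, norm_smul, hu, mul_one, Real.norm_of_nonneg hτ.1]
      rw [n1] at c1
      rw [n2] at c2
      rw [hu, mul_one] at b1 b2
      simp only [e]
      refine (norm_add_le _ _).trans ?_
      linarith)
    (Set.right_mem_Icc.2 hν.le)
  simpa using this

lemma aux_sign_abs (a : ℝ) : |Real.sign a| ≤ 1 := by
  rcases Real.sign_apply_eq a with h | h | h <;> simp [h]

lemma aux_sign_meas : Measurable Real.sign := by
  unfold Real.sign
  refine Measurable.ite measurableSet_Iio (by fun_prop) (Measurable.ite measurableSet_Ioi (by fun_prop) (by fun_prop))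

lemma aux_sign_eq (a b : ℝ) (h : |a - b| < |b|) : Real.sign a = Real.sign b := by
  rcases lt_trichotomy b 0 with hb | hb | hb
  · rw [abs_of_neg hb, abs_lt] at h
    rw [Real.sign_of_neg hb, Real.sign_of_neg (by linarith)]
  · simp [hb] at h
    exact absurd h (not_lt.2 (abs_nonneg _))
  · rw [abs_of_pos hb, abs_lt] at h
    rw [Real.sign_of_pos hb, Real.sign_of_pos (by linarith)]

lemma aux_cbounds {n : ℕ} (hn : 2 ≤ n) (μ : Measure (EuclideanSpace ℝ (Fin (n+1))))
    [IsProbabilityMeasure μ]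
    (hsphere : ∀ᵐ u ∂μ, ‖u‖ = 1)
    (hrot : ∀ R : EuclideanSpace ℝ (Fin (n+1)) ≃ₗᵢ[ℝ] EuclideanSpace ℝ (Fin (n+1)),
      Measure.map (⇑R) μ = μ) (e : EuclideanSpace ℝ (Fin (n+1))) (he : ‖e‖ = 1) :
    1 / √(2 * Real.pi) ≤ √((n+1 : ℕ)) * ∫ u, |⟪e, u⟫| ∂μ ∧
      √((n+1 : ℕ)) * ∫ u, |⟪e, u⟫| ∂μ ≤ 1 := by
  have hbd : ∀ e' : EuclideanSpace ℝ (Fin (n+1)), ‖e'‖ = 1 → ∀ᵐ u ∂μ, |⟪e', u⟫| ≤ 1 := by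
    intro e' he'
    filter_upwards [hsphere] with u hu
    simpa [he', hu] using abs_real_inner_le_norm e' u
  have hint : Integrable (fun u => |⟪e, u⟫|) μ := by
    refine Integrable.of_bound (by fun_prop) 1 ?_
    filter_upwards [hbd e he] with u hu
    simpa using hu
  have hint2 : ∀ e' : EuclideanSpace ℝ (Fin (n+1)), ‖e'‖ = 1 → Integrable (fun u => ⟪e', u⟫ ^ 2) μ := by
    intro e' he'
    refine Integrable.of_bound (by fun_prop) 1 ?_
    filter_upwards [hbd e' he'] with u hu
    simpa using hu
  have hd : (0:ℝ) < √((n+1 : ℕ)) := by positivity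
  have hdd : √((n+1 : ℕ)) * √((n+1 : ℕ)) = ((n+1 : ℕ) : ℝ) := Real.mul_self_sqrt (by positivity)
  constructor
  · set a : ℝ := (6 * √((n+1 : ℕ) / (2 * Real.pi)))⁻¹ with ha
    have hk : 0 < √((n+1 : ℕ) / (2 * Real.pi)) := by positivity
    have ha0 : 0 < a := by positivity
    have hak : a * √((n+1 : ℕ) / (2 * Real.pi)) = 1/6 := by rw [ha]; field_simp
    have b1 := aux_ball hn μ hsphere hrot e he a ha0.le
    have b2 := aux_ball hn μ hsphere hrot e he (2*a) (by positivity)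
    have hm : ∀ t : ℝ, MeasurableSet {u | |⟪e, u⟫| ≤ t} := fun t =>
      measurableSet_le (by fun_prop) (by fun_prop)
    have hi : ∀ t : ℝ, Integrable ({u | |⟪e, u⟫| ≤ t}.indicator (fun _ => (1:ℝ))) μ := fun t =>
      (integrable_const _).indicator (hm t)
    have hv : ∀ t : ℝ, ∫ u, {u | |⟪e, u⟫| ≤ t}.indicator (fun _ => (1:ℝ)) u ∂μ = μ.real {u | |⟪e, u⟫| ≤ t} := by
      intro t; rw [integral_indicator_const _ (hm t)]; simp
    have hA : ∫ u, (2 * a - a * ({u | |⟪e, u⟫| ≤ a}.indicator (fun _ => (1:ℝ)) u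
        + {u | |⟪e, u⟫| ≤ 2*a}.indicator (fun _ => (1:ℝ)) u)) ∂μ ≤ ∫ u, |⟪e, u⟫| ∂μ := by
      refine integral_mono ((integrable_const _).sub (((hi _).add (hi _)).const_mul a)) hint ?_
      intro u
      simp only [Set.indicator_apply, Set.mem_ofPred_eq]
      have := abs_nonneg ⟪e, u⟫
      split_ifs <;> linarith
    have hi3 : Integrable (fun u => a * ({u | |⟪e, u⟫| ≤ a}.indicator (fun _ => (1:ℝ)) u
        + {u | |⟪e, u⟫| ≤ 2*a}.indicator (fun _ => (1:ℝ)) u)) μ := ((hi _).add (hi _)).const_mul a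
    rw [integral_sub (integrable_const _) hi3, integral_const_mul, integral_const_mul,
      integral_add (hi _) (hi _), hv, hv] at hA
    simp only [integral_const, probReal_univ, one_smul] at hA
    have hA2 : a ≤ ∫ u, |⟪e, u⟫| ∂μ := by
      refine le_trans ?_ hA
      nlinarith
    refine le_trans ?_ (mul_le_mul_of_nonneg_left hA2 hd.le)
    rw [ha, Real.sqrt_div (by positivity)]
    have hp : 0 < √(2 * Real.pi) := by positivity
    have hpp : √(2 * Real.pi) * √(2 * Real.pi) = 2 * Real.pi := Real.mul_self_sqrt (by positivity)
    have : √((n+1 : ℕ)) * (6 * (√((n+1 : ℕ)) / √(2 * Real.pi)))⁻¹ = √(2 * Real.pi) / 6 := by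
      field_simp
    rw [this, div_le_div_iff₀ hp (by norm_num), hpp]
    linarith [Real.pi_gt_three]
  · have hsq : ∫ u, ⟪e, u⟫ ^ 2 ∂μ = 1 / ((n+1 : ℕ) : ℝ) := by
      have h1 : ∀ i : Fin (n+1), ∫ u, ⟪EuclideanSpace.single i (1:ℝ), u⟫ ^ 2 ∂μ = ∫ u, ⟪e, u⟫ ^ 2 ∂μ := by
        intro i
        have h2 := aux_rot μ hrot (EuclideanSpace.single i (1:ℝ)) e (by simp [he])
        have h3 := congrArg (fun m => ∫ a, a^2 ∂m) h2
        beta_reduce at h3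
        rwa [integral_map (by fun_prop) (by fun_prop), integral_map (by fun_prop) (by fun_prop)] at h3
      have h4 : ∑ i : Fin (n+1), ∫ u, ⟪EuclideanSpace.single i (1:ℝ), u⟫ ^ 2 ∂μ = 1 := by
        rw [← integral_finsetSum _ fun i _ => hint2 _ (by simp)]
        have : ∫ u, (1:ℝ) ∂μ = 1 := by simp
        rw [← this]
        apply integral_congr_ae
        filter_upwards [hsphere] with u hu
        have := EuclideanSpace.real_norm_sq_eq u
        rw [hu] at this
        simp [EuclideanSpace.inner_single_left, ← this]
      simp only [h1, Finset.sum_const, Finset.card_univ, Fintype.card_fin, nsmul_eq_mul] at h4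
      field_simp; linarith
    have hA : ∫ u, |⟪e, u⟫| ∂μ ≤ ∫ u, (√((n+1 : ℕ)) / 2 * ⟪e, u⟫ ^ 2 + (2 * √((n+1 : ℕ)))⁻¹) ∂μ := by
      refine integral_mono hint (((hint2 e he).const_mul _).add (integrable_const _)) ?_
      intro u
      simp only
      rw [← sq_abs ⟪e, u⟫]
      set z := |⟪e, u⟫|
      have : √((n+1 : ℕ)) / 2 * z ^ 2 + (2 * √((n+1 : ℕ)))⁻¹ - z = (√((n+1 : ℕ)) * z - 1)^2 / (2 * √((n+1 : ℕ))) := by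
        field_simp; ring
      have h2 : 0 ≤ (√((n+1 : ℕ)) * z - 1)^2 / (2 * √((n+1 : ℕ))) := by positivity
      linarith
    rw [integral_add ((hint2 e he).const_mul _) (integrable_const _), integral_const_mul, hsq] at hA
    simp only [integral_const, probReal_univ, one_smul] at hA
    refine (mul_le_mul_of_nonneg_left hA hd.le).trans (le_of_eq ?_)
    rw [show (1 / ((n+1 : ℕ) : ℝ)) = 1 / (√((n+1 : ℕ)) * √((n+1 : ℕ))) by rw [hdd]]
    generalize √((n+1 : ℕ) : ℝ) = z at hd
    field_simp; ring

lemma aux_main_id {d : ℕ} (μ : Measure (EuclideanSpace ℝ (Fin d)))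
    [IsProbabilityMeasure μ]
    (hsphere : ∀ᵐ u ∂μ, ‖u‖ = 1)
    (hrot : ∀ R : EuclideanSpace ℝ (Fin d) ≃ₗᵢ[ℝ] EuclideanSpace ℝ (Fin d),
      Measure.map (⇑R) μ = μ) (e v : EuclideanSpace ℝ (Fin d)) (he : ‖e‖ = 1) :
    ∫ u, Real.sign ⟪e, u⟫ * ⟪u, v⟫ ∂μ = (∫ u, |⟪e, u⟫| ∂μ) * ⟪e, v⟫ := by
  have hint : ∀ w : EuclideanSpace ℝ (Fin d), Integrable (fun u => Real.sign ⟪e, u⟫ * ⟪u, w⟫) μ := by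
    intro w
    refine Integrable.of_bound ?_ ‖w‖ ?_
    · apply Measurable.aestronglyMeasurable
      exact (aux_sign_meas.comp (by fun_prop)).mul (by fun_prop)
    · filter_upwards [hsphere] with u hu
      rw [norm_mul]
      have h1 := aux_sign_abs ⟪e, u⟫
      have h2 := norm_inner_le_norm (𝕜 := ℝ) u w
      rw [hu, one_mul] at h2
      calc _ ≤ 1 * ‖w‖ := mul_le_mul h1 h2 (norm_nonneg _) (by norm_num)
        _ = _ := one_mul _
  set w := v - ⟪e, v⟫ • e with hw
  have hv : v = ⟪e, v⟫ • e + w := by rw [hw]; abel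
  have hwe : ⟪w, e⟫ = 0 := by
    rw [hw, inner_sub_left, real_inner_smul_left, real_inner_self_eq_norm_sq, he, real_inner_comm]
    ring
  have h0 : ∫ u, Real.sign ⟪e, u⟫ * ⟪u, w⟫ ∂μ = 0 := by
    set R := Submodule.reflection (ℝ ∙ w)ᗮ with hR
    have hRw : R w = -w := Submodule.reflection_orthogonalComplement_singleton_eq_neg w
    have hRe : R e = e := Submodule.reflection_mem_subspace_eq_self
      (Submodule.mem_orthogonal_singleton_iff_inner_right.2 hwe)
    have h1 : ∫ u, Real.sign ⟪e, u⟫ * ⟪u, w⟫ ∂μ = ∫ u, Real.sign ⟪e, R u⟫ * ⟪R u, w⟫ ∂μ := by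
      conv_lhs => rw [← hrot R]
      rw [integral_map (by fun_prop)]
      apply Measurable.aestronglyMeasurable
      exact (aux_sign_meas.comp (by fun_prop)).mul (by fun_prop)
    have h2 : ∀ u, Real.sign ⟪e, R u⟫ * ⟪R u, w⟫ = - (Real.sign ⟪e, u⟫ * ⟪u, w⟫) := by
      intro u
      have a1 : ⟪e, R u⟫ = ⟪e, u⟫ := by
        conv_lhs => rw [← hRe]
        exact R.inner_map_map _ _
      have a2 : ⟪R u, w⟫ = - ⟪u, w⟫ := by
        have : ⟪R u, R w⟫ = ⟪u, w⟫ := R.inner_map_map _ _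
        rw [hRw, inner_neg_right] at this
        linarith
      rw [a1, a2]; ring
    simp only [h2] at h1
    rw [integral_neg] at h1
    linarith
  have h3 : ∀ u, Real.sign ⟪e, u⟫ * ⟪u, v⟫ = |⟪e, u⟫| * ⟪e, v⟫ + Real.sign ⟪e, u⟫ * ⟪u, w⟫ := by
    intro u
    have : ⟪u, v⟫ = ⟪e, v⟫ * ⟪e, u⟫ + ⟪u, w⟫ := by
      conv_lhs => rw [hv]
      rw [inner_add_right, real_inner_smul_right, real_inner_comm u e]
    have h4 : Real.sign ⟪e, u⟫ * ⟪e, u⟫ = |⟪e, u⟫| := by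
      rcases lt_trichotomy ⟪e, u⟫ 0 with h | h | h
      · rw [Real.sign_of_neg h, abs_of_neg h]; ring
      · simp [h]
      · rw [Real.sign_of_pos h, abs_of_pos h]; ring
    rw [this, ← h4]; ring
  simp only [h3]
  rw [integral_add _ (hint w), h0, integral_mul_const, add_zero]
  apply Integrable.mul_const
  refine Integrable.of_bound (by fun_prop) 1 ?_
  filter_upwards [hsphere] with u hu
  simpa [he, hu] using abs_real_inner_le_norm e u

theorem stmt19 (d : ℕ) (hd : 3 ≤ d)
    (μ : Measure (EuclideanSpace ℝ (Fin d))) [IsProbabilityMeasure μ]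
    (hsphere : ∀ᵐ u ∂μ, ‖u‖ = 1)
    (hrot : ∀ R : EuclideanSpace ℝ (Fin d) ≃ₗᵢ[ℝ] EuclideanSpace ℝ (Fin d),
      Measure.map (⇑R) μ = μ)
    (f : EuclideanSpace ℝ (Fin d) → ℝ)
    (g : EuclideanSpace ℝ (Fin d) → EuclideanSpace ℝ (Fin d)) (L : ℝ) (hL : 0 ≤ L)
    (hg : ∀ y, HasGradientAt f (g y) y)
    (hLip : ∀ y z, ‖g y - g z‖ ≤ L * ‖y - z‖)
    (x : EuclideanSpace ℝ (Fin d)) (hx : g x ≠ 0)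
    (ν : ℝ) (hν : 0 < ν)
    (v : EuclideanSpace ℝ (Fin d)) (hv : ‖v‖ = 1)
    (c γ : ℝ)
    (hc : c = Real.sqrt d * ∫ u, |u ⟨0, by omega⟩| ∂μ)
    (hγ : γ = Real.sqrt ((d : ℝ) / (2 * Real.pi)) * (L * ν / ‖g x‖)) :
    (1 / Real.sqrt (2 * Real.pi) ≤ c ∧ c ≤ 1)
    ∧ |(∫ u, Real.sign (f (x + ν • u) - f (x - ν • u)) * ⟪u, v⟫ ∂μ)
        - (c / Real.sqrt d) * ⟪‖g x‖⁻¹ • g x, v⟫| ≤ 2 * γ := by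
  obtain ⟨n, rfl⟩ : ∃ n, d = n + 1 := ⟨d - 1, by omega⟩
  have hn : 2 ≤ n := by omega
  have hgx : 0 < ‖g x‖ := norm_pos_iff.2 hx
  set e : EuclideanSpace ℝ (Fin (n+1)) := ‖g x‖⁻¹ • g x with he
  have hen : ‖e‖ = 1 := by
    rw [he, norm_smul, norm_inv, norm_norm, inv_mul_cancel₀ hgx.ne']
  have hge : ∀ u, ⟪g x, u⟫ = ‖g x‖ * ⟪e, u⟫ := by
    intro u
    rw [he, real_inner_smul_left, mul_inv_cancel_left₀ hgx.ne']
  have hA : ∫ u, |u ⟨0, by omega⟩| ∂μ = ∫ u, |⟪e, u⟫| ∂μ := by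
    have h2 := aux_rot μ hrot (EuclideanSpace.single 0 (1:ℝ)) e (by simp [hen])
    have h3 := congrArg (fun m => ∫ a, |a| ∂m) h2
    beta_reduce at h3
    rw [integral_map (by fun_prop) (by fun_prop), integral_map (by fun_prop) (by fun_prop)] at h3
    rw [← h3]
    congr 1; ext u
    simp [EuclideanSpace.inner_single_left]
  rw [hA] at hc
  refine ⟨by rw [hc]; exact aux_cbounds hn μ hsphere hrot e hen, ?_⟩
  have hd : (0:ℝ) < √((n+1 : ℕ)) := by positivity
  have hcd : c / √((n+1 : ℕ)) = ∫ u, |⟪e, u⟫| ∂μ := by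
    rw [hc]; field_simp
  rw [hcd, ← aux_main_id μ hsphere hrot e v hen]
  have hfc : Continuous f := continuous_iff_continuousAt.2 fun y => (hg y).continuousAt
  have hbd : ∀ (a : ℝ) u, ‖u‖ = 1 → |Real.sign a * ⟪u, v⟫| ≤ 1 := by
    intro a u hu
    rw [abs_mul]
    have h1 := aux_sign_abs a
    have h2 := abs_real_inner_le_norm u v
    rw [hu, hv, one_mul] at h2
    exact mul_le_one₀ h1 (abs_nonneg _) h2
  have hi1 : Integrable (fun u => Real.sign (f (x + ν • u) - f (x - ν • u)) * ⟪u, v⟫) μ := by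
    refine Integrable.of_bound ?_ 1 ?_
    · apply Measurable.aestronglyMeasurable
      refine (aux_sign_meas.comp (Continuous.measurable ?_)).mul (by fun_prop)
      fun_prop
    · filter_upwards [hsphere] with u hu using hbd _ u hu
  have hi2 : Integrable (fun u => Real.sign ⟪e, u⟫ * ⟪u, v⟫) μ := by
    refine Integrable.of_bound ?_ 1 ?_
    · apply Measurable.aestronglyMeasurable
      exact (aux_sign_meas.comp (by fun_prop)).mul (by fun_prop)
    · filter_upwards [hsphere] with u hu using hbd _ u hu
  rw [← integral_sub hi1 hi2]
  set t : ℝ := L * ν / ‖g x‖ / 2 with ht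
  have ht0 : 0 ≤ t := by positivity
  have hm : MeasurableSet {u | |⟪e, u⟫| ≤ t} := measurableSet_le (by fun_prop) (by fun_prop)
  have hball := aux_ball hn μ hsphere hrot e hen t ht0
  calc |∫ u, (Real.sign (f (x + ν • u) - f (x - ν • u)) * ⟪u, v⟫ - Real.sign ⟪e, u⟫ * ⟪u, v⟫) ∂μ|
      ≤ ∫ u, {u | |⟪e, u⟫| ≤ t}.indicator (fun _ => (2:ℝ)) u ∂μ := by
        have hi3 : Integrable ({u | |⟪e, u⟫| ≤ t}.indicator (fun _ => (2:ℝ))) μ :=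
          (integrable_const _).indicator hm
        rw [← Real.norm_eq_abs]
        refine norm_integral_le_of_norm_le hi3 ?_
        filter_upwards [hsphere] with u hu
        by_cases hb : |⟪e, u⟫| ≤ t
        · rw [Set.indicator_of_mem (by exact hb)]
          refine (norm_sub_le _ _).trans ?_
          have h1 := hbd (f (x + ν • u) - f (x - ν • u)) u hu
          have h2 := hbd ⟪e, u⟫ u hu
          simp only [Real.norm_eq_abs]
          linarith
        · rw [Set.indicator_of_notMem (by exact hb)]
          have hT := aux_taylor f g L hg hLip x u hu ν hν
          have hs1 : Real.sign (f (x + ν • u) - f (x - ν • u)) = Real.sign (2 * ν * ⟪g x, u⟫) := by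
            apply aux_sign_eq
            refine hT.trans_lt ?_
            rw [hge, abs_mul (2 * ν), abs_mul ‖g x‖, abs_of_pos hgx, abs_of_pos (by positivity : 0 < 2 * ν)]
            push Not at hb
            rw [ht, div_div, div_lt_iff₀ (by positivity)] at hb
            nlinarith
          have hs2 : Real.sign (2 * ν * ⟪g x, u⟫) = Real.sign ⟪e, u⟫ := by
            rw [hge]
            have hpos : 0 < 2 * ν * ‖g x‖ := by positivity
            rw [← mul_assoc]
            rcases lt_trichotomy ⟪e, u⟫ 0 with h | h | h
            · rw [Real.sign_of_neg h, Real.sign_of_neg (mul_neg_of_pos_of_neg hpos h)]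
            · simp [h]
            · rw [Real.sign_of_pos h, Real.sign_of_pos (mul_pos hpos h)]
          rw [hs1, hs2]; simp
    _ = 2 * μ.real {u | |⟪e, u⟫| ≤ t} := by
        rw [integral_indicator_const _ hm, smul_eq_mul, mul_comm]
    _ ≤ 2 * γ := by
        have : γ = 2 * t * √((n+1 : ℕ) / (2 * Real.pi)) := by rw [hγ, ht]; ring
        rw [this]
        linarith
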